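/- arXiv:2004.14450 — 2 statements merged into one kernel-verified Lean document; each statement's English description precedes it below -/
import Mathlib

section
/- Let σ₀ be a real number, and let (a_n)_{n≥1}, (b_n)_{n≥1} be sequences of complex numbers with Σ_{n≥1} |a_n|·n^{−σ₀} < ∞ and Σ_{n≥1} |b_n|·n^{−σ₀} < ∞. Assume a_n ≠ 0 for at least one n. Let P, Q be complex polynomials with Q not identically zero, and suppose that Q(s)·Σ_{n≥1} a_n n^{−s} = P(s)·Σ_{n≥1} b_n n^{−s} for all sufficiently large real s. Then the b_n are not all zero, the least index m with a_m ≠ 0 equals the least index n with b_n ≠ 0, and there is a nonzero constant c ∈ ℂ with P = c·Q as polynomials. -/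
open Finset
open scoped Classical

section helpers
open Filter Topology

lemma poly_decay (P : Polynomial ℂ) {x y : ℕ} (hx : 1 ≤ x) (hxy : x < y) :
    Tendsto (fun s : ℝ => P.eval (s : ℂ) * ((x : ℂ) ^ (s : ℂ) / (y : ℂ) ^ (s : ℂ))) atTop (𝓝 0) := by
  have hx0 : (0:ℝ) < x := by exact_mod_cast hx
  have hy0 : (0:ℝ) < y := by exact_mod_cast (by omega : 0 < y)
  have hb : 0 < Real.log y - Real.log x := by
    have := Real.log_lt_log hx0 (by exact_mod_cast hxy : (x:ℝ) < y)
    linarith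
  induction P using Polynomial.induction_on' with
  | add p q hp hq =>
    have := hp.add hq
    simpa [add_mul] using this
  | monomial n c =>
    have h := tendsto_rpow_mul_exp_neg_mul_atTop_nhds_zero n _ hb
    have h2 : Tendsto (fun s : ℝ => c * ((s ^ (n:ℝ) * Real.exp (-(Real.log y - Real.log x) * s) : ℝ) : ℂ)) atTop (𝓝 0) := by
      have := ((Complex.continuous_ofReal.tendsto 0).comp h).const_mul c
      simpa using this
    refine h2.congr fun s => ?_
    have e : Real.exp (-(Real.log y - Real.log x) * s) = (x:ℝ)^s / (y:ℝ)^s := by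
      rw [Real.rpow_def_of_pos hx0, Real.rpow_def_of_pos hy0, ← Real.exp_sub]
      congr 1; ring
    rw [e, Real.rpow_natCast, Complex.ofReal_mul, Complex.ofReal_div, Complex.ofReal_cpow hx0.le, Complex.ofReal_cpow hy0.le]
    simp [mul_assoc]

lemma poly_zero (Q : Polynomial ℂ) (h : Tendsto (fun s : ℝ => Q.eval (s : ℂ)) atTop (𝓝 0)) :
    Q = 0 := by
  by_cases hd : 0 < Q.degree
  · have h1 := Q.tendsto_norm_atTop hd (l := atTop) (z := fun s : ℝ => (s : ℂ)) (by
      simpa using tendsto_abs_atTop_atTop)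
    exact absurd h.norm (not_tendsto_nhds_of_tendsto_atTop h1 _)
  · rw [Polynomial.eq_C_of_degree_le_zero (not_lt.mp hd)] at h ⊢
    simp only [Polynomial.eval_C, tendsto_const_nhds_iff] at h
    simp [h]

lemma idx_le (A B : ℝ → ℂ) (P Q : Polynomial ℂ) (m n : ℕ) (am bn : ℂ)
    (hm : 1 ≤ m) (ham : am ≠ 0) (hQ : Q ≠ 0)
    (hA : Tendsto (fun s : ℝ => (m:ℂ)^(s:ℂ) * A s) atTop (𝓝 am))
    (hB : Tendsto (fun s : ℝ => (n:ℂ)^(s:ℂ) * B s) atTop (𝓝 bn))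
    (h : ∀ᶠ s : ℝ in atTop, Q.eval (s:ℂ) * A s = P.eval (s:ℂ) * B s) : n ≤ m := by
  by_contra! hmn
  apply hQ
  apply poly_zero
  have h1 := ((poly_decay P hm hmn).mul hB).mul (hA.inv₀ ham)
  rw [zero_mul, zero_mul] at h1
  refine h1.congr' ?_
  filter_upwards [h, hA.eventually_ne ham] with s hs hne
  have hn : (n:ℂ)^(s:ℂ) ≠ 0 := by
    rw [Complex.cpow_ne_zero_iff]; left; exact_mod_cast (by omega : n ≠ 0)
  have h3 : (m:ℂ)^(s:ℂ) ≠ 0 := left_ne_zero_of_mul hne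
  have h4 : A s ≠ 0 := right_ne_zero_of_mul hne
  field_simp
  linear_combination -hs

open LSeries in
lemma lead (a : ℕ → ℂ) (ha : abscissaOfAbsConv a < ⊤) (m : ℕ)
    (hm : IsLeast {n : ℕ | 1 ≤ n ∧ a n ≠ 0} m) :
    Tendsto (fun s : ℝ => (m:ℂ)^(s:ℂ) * LSeries a s) atTop (𝓝 (a m)) := by
  obtain ⟨⟨h1, h2⟩, hl⟩ := hm
  obtain ⟨k, rfl⟩ : ∃ k, m = k + 1 := ⟨m - 1, by omega⟩
  have hc : ∀ {n : ℕ}, n ≠ 0 → a n = Function.update a 0 0 n := fun hn => by simp [hn]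
  have hz : ∀ j ≤ k, Function.update a 0 0 j = 0 := by
    intro j hj
    rcases Nat.eq_zero_or_pos j with rfl | hj0
    · simp
    · rw [← hc hj0.ne']
      by_contra hne
      have := hl ⟨hj0, hne⟩
      omega
  have h := LSeries.tendsto_cpow_mul_atTop hz (by rwa [← abscissaOfAbsConv_congr hc])
  rw [← hc (Nat.succ_ne_zero k)] at h
  refine h.congr fun s => ?_
  rw [← LSeries_congr hc]
  push_cast; rfl

lemma exists_least (a : ℕ → ℂ) (h : ∃ n : ℕ, 1 ≤ n ∧ a n ≠ 0) :
    ∃ m, IsLeast {n : ℕ | 1 ≤ n ∧ a n ≠ 0} m :=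
  ⟨_, Nat.sInf_mem h, fun _ hn => Nat.sInf_le hn⟩

lemma nonvan (a : ℕ → ℂ) (ha : LSeries.abscissaOfAbsConv a < ⊤) (m : ℕ)
    (hm : IsLeast {n : ℕ | 1 ≤ n ∧ a n ≠ 0} m) : ∀ᶠ s : ℝ in atTop, LSeries a s ≠ 0 := by
  filter_upwards [(lead a ha m hm).eventually_ne hm.1.2] with s hs
  exact right_ne_zero_of_mul hs

lemma poly_nonvan (Q : Polynomial ℂ) (hQ : Q ≠ 0) : ∀ᶠ s : ℝ in atTop, Q.eval (s:ℂ) ≠ 0 := by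
  have hf : {s : ℝ | Q.eval (s:ℂ) = 0}.Finite := by
    have : {z : ℂ | Q.eval z = 0}.Finite := by
      simpa [Polynomial.IsRoot] using Polynomial.finite_setOf_isRoot hQ
    exact this.preimage Complex.ofReal_injective.injOn
  obtain ⟨M, hM⟩ := hf.bddAbove
  filter_upwards [eventually_gt_atTop M] with s hs h0
  exact absurd (hM h0) (not_le.mpr hs)

lemma core (a b : ℕ → ℂ) (P Q : Polynomial ℂ) (hQ : Q ≠ 0)
    (ha : LSeries.abscissaOfAbsConv a < ⊤) (hb : LSeries.abscissaOfAbsConv b < ⊤)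
    (h : ∀ᶠ s : ℝ in atTop, Q.eval (s:ℂ) * LSeries a s = P.eval (s:ℂ) * LSeries b s)
    (hane : ∃ n : ℕ, 1 ≤ n ∧ a n ≠ 0) :
    ∃ m, IsLeast {n : ℕ | 1 ≤ n ∧ a n ≠ 0} m ∧ IsLeast {n : ℕ | 1 ≤ n ∧ b n ≠ 0} m := by
  obtain ⟨m, hm⟩ := exists_least a hane
  have hne : ∀ᶠ s : ℝ in atTop, P.eval (s:ℂ) * LSeries b s ≠ 0 := by
    filter_upwards [h, nonvan a ha m hm, poly_nonvan Q hQ] with s hs h1 h2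
    rw [← hs]
    exact mul_ne_zero h2 h1
  obtain ⟨s, hs⟩ := hne.exists
  have hP : P ≠ 0 := by
    rintro rfl
    simp at hs
  have hbne : ∃ n : ℕ, 1 ≤ n ∧ b n ≠ 0 := by
    by_contra! hcon
    apply right_ne_zero_of_mul hs
    rw [LSeries_congr (g := 0) (fun {n} hn => hcon n (Nat.pos_of_ne_zero hn))]
    simp
  obtain ⟨n, hn⟩ := exists_least b hbne
  have h1 := idx_le _ _ P Q m n _ _ hm.1.1 hm.1.2 hQ (lead a ha m hm) (lead b hb n hn) h
  have h2 := idx_le _ _ Q P n m _ _ hn.1.1 hn.1.2 hP (lead b hb n hn) (lead a ha m hm)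
    (h.mono fun _ h => h.symm)
  obtain rfl : m = n := le_antisymm h2 h1
  exact ⟨m, hm, hn⟩

lemma summ (σ₀ : ℝ) (a : ℕ → ℂ)
    (ha : Summable (fun n : ℕ => ‖a (n + 1)‖ * ((n + 1 : ℕ) : ℝ) ^ (-σ₀))) :
    LSeriesSummable a σ₀ := by
  rw [LSeriesSummable, ← summable_nat_add_iff 1]
  refine Summable.of_norm (ha.congr fun n => ?_)
  rw [LSeries.norm_term_eq, if_neg (Nat.succ_ne_zero n), Real.rpow_neg (Nat.cast_nonneg _)]
  simp [div_eq_mul_inv]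

lemma lser (σ₀ : ℝ) (a : ℕ → ℂ) (ha : LSeriesSummable a σ₀) (s : ℝ) (hs : σ₀ ≤ s) :
    ∑' n : ℕ, a (n + 1) * ((n + 1 : ℕ) : ℂ) ^ (-(s : ℂ)) = LSeries a s := by
  have h : LSeriesSummable a s := ha.of_re_le_re (by simpa using hs)
  rw [LSeries, h.tsum_eq_zero_add]
  simp only [LSeries.term_zero, zero_add]
  refine tsum_congr fun n => ?_
  rw [LSeries.term_of_ne_zero (Nat.succ_ne_zero n), Complex.cpow_neg, div_eq_mul_inv]

end helpers

/-- rigidity for Dirichlet series. If `Q(s) Σ a_n n^{-s} = P(s) Σ b_n n^{-s}`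
for all large real `s`, with both series absolutely convergent and `(a_n)` not
identically zero, then `(b_n)` is not identically zero, the least nonvanishing indices
agree, and `P` is a nonzero constant multiple of `Q`. -/
theorem stmt_9 (σ₀ : ℝ) (a b : ℕ → ℂ)
    (ha : Summable (fun n : ℕ => ‖a (n + 1)‖ * ((n + 1 : ℕ) : ℝ) ^ (-σ₀)))
    (hb : Summable (fun n : ℕ => ‖b (n + 1)‖ * ((n + 1 : ℕ) : ℝ) ^ (-σ₀)))
    (hane : ∃ n : ℕ, 1 ≤ n ∧ a n ≠ 0)
    (P Q : Polynomial ℂ) (hQ : Q ≠ 0)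
    (heq : ∃ s₀ : ℝ, ∀ s : ℝ, s₀ ≤ s →
      Q.eval (s : ℂ) * ∑' n : ℕ, a (n + 1) * ((n + 1 : ℕ) : ℂ) ^ (-(s : ℂ))
        = P.eval (s : ℂ) * ∑' n : ℕ, b (n + 1) * ((n + 1 : ℕ) : ℂ) ^ (-(s : ℂ))) :
    (∃ n : ℕ, 1 ≤ n ∧ b n ≠ 0) ∧
    sInf {n : ℕ | 1 ≤ n ∧ a n ≠ 0} = sInf {n : ℕ | 1 ≤ n ∧ b n ≠ 0} ∧
    ∃ c : ℂ, c ≠ 0 ∧ P = Polynomial.C c * Q := by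
  have hA := summ σ₀ a ha
  have hB := summ σ₀ b hb
  have haa : LSeries.abscissaOfAbsConv a < ⊤ :=
    hA.abscissaOfAbsConv_le.trans_lt (EReal.coe_lt_top _)
  have hbb : LSeries.abscissaOfAbsConv b < ⊤ :=
    hB.abscissaOfAbsConv_le.trans_lt (EReal.coe_lt_top _)
  obtain ⟨s₀, h0⟩ := heq
  have h : ∀ᶠ s : ℝ in Filter.atTop,
      Q.eval (s:ℂ) * LSeries a s = P.eval (s:ℂ) * LSeries b s := by
    filter_upwards [Filter.eventually_ge_atTop s₀, Filter.eventually_ge_atTop σ₀] with s h1 h2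
    rw [← lser σ₀ a hA s h2, ← lser σ₀ b hB s h2]
    exact h0 s h1
  obtain ⟨m, hm, hn⟩ := core a b P Q hQ haa hbb h hane
  refine ⟨⟨m, hn.1⟩, hm.csInf_eq.trans hn.csInf_eq.symm, a m / b m,
    div_ne_zero hm.1.2 hn.1.2, ?_⟩
  set c := a m / b m with hc
  have hS : LSeriesSummable (a - c • b) σ₀ := hA.sub (hB.smul c)
  have hdd : LSeries.abscissaOfAbsConv (a - c • b) < ⊤ :=
    hS.abscissaOfAbsConv_le.trans_lt (EReal.coe_lt_top _)
  have hL : ∀ s : ℝ, σ₀ ≤ s → LSeries (a - c • b) s = LSeries a s - c * LSeries b s := by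
    intro s hs
    have h1 : LSeriesSummable a s := hA.of_re_le_re (by simpa using hs)
    have h2 : LSeriesSummable b s := hB.of_re_le_re (by simpa using hs)
    rw [LSeries_sub h1 (h2.smul c), LSeries_smul]
  have hd : ¬ ∃ n : ℕ, 1 ≤ n ∧ (a - c • b) n ≠ 0 := by
    intro hex
    obtain ⟨k, hk, hk'⟩ := core (a - c • b) b (P - Polynomial.C c * Q) Q hQ hdd hbb (by
      filter_upwards [h, Filter.eventually_ge_atTop σ₀] with s h1 h2
      rw [hL s h2]
      simp only [Polynomial.eval_sub, Polynomial.eval_mul, Polynomial.eval_C]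
      linear_combination h1) hex
    obtain rfl := hk'.unique hn
    apply hk.1.2
    have := hn.1.2
    simp [hc, div_mul_cancel₀ _ this]
  by_contra hne
  have hev := poly_nonvan (P - Polynomial.C c * Q) (sub_ne_zero.mpr hne)
  have hfalse : ∀ᶠ s : ℝ in Filter.atTop, False := by
    filter_upwards [h, hev, nonvan b hbb m hn, Filter.eventually_ge_atTop σ₀] with s h1 h2 h3 h4
    have h5 := hL s h4
    push Not at hd
    rw [LSeries_congr (g := 0) (fun {n} hn => hd n (Nat.pos_of_ne_zero hn))] at h5
    simp only [LSeries_zero, Pi.zero_apply] at h5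
    apply mul_ne_zero h2 h3
    simp only [Polynomial.eval_sub, Polynomial.eval_mul, Polynomial.eval_C]
    linear_combination -h1 - Polynomial.eval (s:ℂ) Q * h5
  exact hfalse.exists.elim fun _ h => h
end

section
/- Let a : ℕ → ℝ be a multiplicative arithmetic function (a(1) = 1 and a(mn) = a(m)·a(n) whenever gcd(m, n) = 1). Let n₁, n₂, n₃, n₄, n₅, n₆ be squarefree positive integers such that the product n₁n₂n₃n₄n₅n₆ is a perfect square. Then a(n₁)·a(n₂)·a(n₃)·a(n₄)·a(n₅)·a(n₆) ≥ 0. -/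
theorem aux_mul (a : ℕ → ℝ) (m n : ℕ) (hm : m ≠ 0) (hn : n ≠ 0) :
    ((m * n).factorization.prod fun p k => a p ^ k)
      = (m.factorization.prod fun p k => a p ^ k) * (n.factorization.prod fun p k => a p ^ k) := by
  rw [Nat.factorization_mul hm hn]
  exact Finsupp.prod_add_index' (fun _ => pow_zero _) (fun _ _ _ => pow_add _ _ _)

theorem aux_sqf (a : ℕ → ℝ) (ha1 : a 1 = 1)
    (hmul : ∀ m n : ℕ, Nat.Coprime m n → a (m * n) = a m * a n) (n : ℕ) (h : Squarefree n) :
    a n = n.factorization.prod fun p k => a p ^ k := by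
  rw [Nat.multiplicative_factorization a hmul ha1 h.ne_zero]
  refine Finset.prod_congr rfl fun p _ => ?_
  have h1 : n.factorization p ≤ 1 := h.natFactorization_le_one p
  obtain h0 | h0 : n.factorization p = 0 ∨ n.factorization p = 1 := by omega
  · simp [h0, ha1]
  · simp [h0]


/-- if `a` is a real multiplicative arithmetic function and
`n₁ ⋯ n₆` are squarefree with square product, then `a(n₁) ⋯ a(n₆) ≥ 0`. -/
theorem stmt_18 (a : ℕ → ℝ) (ha1 : a 1 = 1)
    (hmul : ∀ m n : ℕ, Nat.Coprime m n → a (m * n) = a m * a n)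
    (n₁ n₂ n₃ n₄ n₅ n₆ : ℕ)
    (h₁ : Squarefree n₁) (h₂ : Squarefree n₂) (h₃ : Squarefree n₃)
    (h₄ : Squarefree n₄) (h₅ : Squarefree n₅) (h₆ : Squarefree n₆)
    (hsq : IsSquare (n₁ * n₂ * n₃ * n₄ * n₅ * n₆)) :
    0 ≤ a n₁ * a n₂ * a n₃ * a n₄ * a n₅ * a n₆ := by
  have e₁ := h₁.ne_zero
  have e₂ := h₂.ne_zero
  have e₃ := h₃.ne_zero
  have e₄ := h₄.ne_zero
  have e₅ := h₅.ne_zero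
  have e₆ := h₆.ne_zero
  have h0 : n₁ * n₂ * n₃ * n₄ * n₅ * n₆ ≠ 0 := by positivity
  rw [aux_sqf a ha1 hmul n₁ h₁, aux_sqf a ha1 hmul n₂ h₂, aux_sqf a ha1 hmul n₃ h₃,
    aux_sqf a ha1 hmul n₄ h₄, aux_sqf a ha1 hmul n₅ h₅, aux_sqf a ha1 hmul n₆ h₆,
    ← aux_mul a _ _ (by positivity) (by positivity),
    ← aux_mul a _ _ (by positivity) (by positivity),
    ← aux_mul a _ _ (by positivity) (by positivity),
    ← aux_mul a _ _ (by positivity) (by positivity),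
    ← aux_mul a _ _ (by positivity) (by positivity)]
  obtain ⟨r, hr⟩ := hsq
  rw [hr] at h0 ⊢
  have hr0 : r ≠ 0 := left_ne_zero_of_mul h0
  rw [aux_mul a r r hr0 hr0]
  exact mul_self_nonneg _
end
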